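/- Let G = ⟨α, τ : α^n = τ^2 = 1, τα = α^{-1}τ⟩ be the dihedral group of order 2n where n ≥ 3 is odd, let H ≤ ⟨α⟩ be a subgroup and z ∈ ℤ/nℤ such that H_z = ⟨H, τα^z⟩ is a proper subgroup of G, and let U be an atom of B(G). Then |U_{H_z}| ≤ n + |H| − 1, and equality is only possible if H is the trivial subgroup. -/

import Mathlib

namespace ProductOne

open scoped Classical

variable {G : Type*} [Group G]

/-- `S` is a product-one sequence over `G`: its terms can be ordered with product `1`. -/
def IsProductOne (S : Multiset G) : Prop :=
  ∃ l : List G, (l : Multiset G) = S ∧ l.prod = 1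

/-- `S` is an atom (a minimal product-one sequence): it is a nontrivial product-one
sequence that is not the concatenation of two nontrivial product-one sequences. -/
def IsAtomSeq (S : Multiset G) : Prop :=
  S ≠ 0 ∧ IsProductOne S ∧
    ∀ A B : Multiset G, S = A + B → IsProductOne A → IsProductOne B → A = 0 ∨ B = 0

/-- `S` is a sequence over the subset `G₀ ⊆ G`. -/
def SeqOn (G₀ : Set G) (S : Multiset G) : Prop := ∀ g ∈ S, g ∈ G₀

/-- `S` is an atom of the monoid `B(G₀)` of product-one sequences over `G₀`. -/
def IsAtomSeqOn (G₀ : Set G) (S : Multiset G) : Prop := SeqOn G₀ S ∧ IsAtomSeq S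

/-- The set of lengths `L(A)` of factorizations of `A` into atoms over `G₀`. -/
def lengthsOn (G₀ : Set G) (A : Multiset G) : Set ℕ :=
  {k | ∃ f : Multiset (Multiset G), Multiset.card f = k ∧
        (∀ U ∈ f, IsAtomSeqOn G₀ U) ∧ f.sum = A}

/-- The set of lengths `L(A)` over the whole group. -/
def lengths (A : Multiset G) : Set ℕ := lengthsOn Set.univ A

/-- The set of distances of a set `L ⊆ ℕ`. -/
def distancesOf (L : Set ℕ) : Set ℕ :=
  {d | 0 < d ∧ ∃ a, a ∈ L ∧ a + d ∈ L ∧ ∀ b ∈ L, ¬(a < b ∧ b < a + d)}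

/-- The set of distances `Δ(G₀)` of the monoid `B(G₀)`. -/
def DeltaOn (G₀ : Set G) : Set ℕ :=
  {d | ∃ A : Multiset G, SeqOn G₀ A ∧ IsProductOne A ∧ d ∈ distancesOf (lengthsOn G₀ A)}

/-- The set of distances `Δ(G)` of `B(G)`. -/
def Delta (G : Type*) [Group G] : Set ℕ := DeltaOn (Set.univ : Set G)

/-- The large Davenport constant of `G₀`: maximal length of an atom of `B(G₀)`. -/
noncomputable def DavenportOn (G₀ : Set G) : ℕ :=
  sSup {k | ∃ S : Multiset G, IsAtomSeqOn G₀ S ∧ Multiset.card S = k}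

/-- The large Davenport constant `D(G)`. -/
noncomputable def Davenport (G : Type*) [Group G] : ℕ :=
  DavenportOn (Set.univ : Set G)

/-- The small Davenport constant `d(G₀)`: maximal length of a product-one free
sequence over `G₀`. -/
noncomputable def smallDavenportOn (G₀ : Set G) : ℕ :=
  sSup {k | ∃ S : Multiset G, SeqOn G₀ S ∧ Multiset.card S = k ∧
        ∀ T : Multiset G, T ≤ S → T ≠ 0 → ¬IsProductOne T}

/-- `Δ*(G) = {min Δ(G₀) : G₀ ⊆ G with Δ(G₀) ≠ ∅}`. -/
def DeltaStar (G : Type*) [Group G] : Set ℕ :=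
  {d | ∃ G₀ : Set G, (DeltaOn G₀).Nonempty ∧ d = sInf (DeltaOn G₀)}

/-- The elasticity `ρ(L) = max L / min L` of a set of lengths (with the set of
positive elements used, and `ρ = 1` if there are none). -/
noncomputable def elasticity (L : Set ℕ) : ℚ :=
  if (L ∩ {k | 0 < k}).Nonempty then
    ((sSup (L ∩ {k | 0 < k}) : ℕ) : ℚ) / ((sInf (L ∩ {k | 0 < k}) : ℕ) : ℚ)
  else 1

/-- The elasticity `ρ(G₀)` of the monoid `B(G₀)`. -/
noncomputable def rhoOn (G₀ : Set G) : ℝ :=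
  sSup {x : ℝ | ∃ A : Multiset G, SeqOn G₀ A ∧ IsProductOne A ∧
    x = (elasticity (lengthsOn G₀ A) : ℝ)}

/-- `Δ*_ρ(G) = {min Δ(G₀) : G₀ ⊆ G with ρ(G₀) = D(G)/2}`. -/
noncomputable def DeltaRhoStar (G : Type*) [Group G] : Set ℕ :=
  {d | ∃ G₀ : Set G, rhoOn G₀ = (Davenport G : ℝ) / 2 ∧ d = sInf (DeltaOn G₀)}

/-- Divisibility in the monoid `B(G)`. -/
def BDvd (A S : Multiset G) : Prop :=
  ∃ C : Multiset G, IsProductOne C ∧ S = A + C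

/-- The `ω`-invariant `ω(B(G), A)`. -/
noncomputable def omegaAt (A : Multiset G) : ℕ∞ :=
  sInf {N : ℕ∞ | ∀ f : Multiset (Multiset G),
    (∀ B ∈ f, IsProductOne B) → BDvd A f.sum →
    ∃ t ≤ f, (Multiset.card t : ℕ∞) ≤ N ∧ BDvd A t.sum}

/-- `ω(G) = sup {ω(B(G), U) : U an atom of B(G)}`. -/
noncomputable def omegaInv (G : Type*) [Group G] : ℕ∞ :=
  ⨆ U ∈ {U : Multiset G | IsAtomSeq U}, omegaAt U

/-- `z` is a factorization of `A` into atoms. -/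
def IsFactorization (A : Multiset G) (z : Multiset (Multiset G)) : Prop :=
  (∀ U ∈ z, IsAtomSeq U) ∧ z.sum = A

/-- The distance between two factorizations. -/
noncomputable def factDist (z z' : Multiset (Multiset G)) : ℕ :=
  letI := Classical.decEq (Multiset G)
  max (Multiset.card (z - z')) (Multiset.card (z' - z))

/-- The catenary degree `c(A)`. -/
noncomputable def catenaryAt (A : Multiset G) : ℕ∞ :=
  sInf {N : ℕ∞ | ∀ z z' : Multiset (Multiset G),
    IsFactorization A z → IsFactorization A z' →
    Relation.ReflTransGen
      (fun x y => IsFactorization A y ∧ (factDist x y : ℕ∞) ≤ N) z z'}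

/-- The set of positive catenary degrees `Ca(G)`. -/
noncomputable def CatenarySet (G : Type*) [Group G] : Set ℕ∞ :=
  {c | ∃ A : Multiset G, IsProductOne A ∧ catenaryAt A = c ∧ 0 < c}

/-- The catenary degree `c(G)` of `B(G)`. -/
noncomputable def catenaryDegree (G : Type*) [Group G] : ℕ∞ :=
  ⨆ A ∈ {A : Multiset G | IsProductOne A}, catenaryAt A

/-- The cross number `k(S)` of a sequence. -/
noncomputable def crossNumber (S : Multiset G) : ℚ :=
  (S.map fun g => (1 : ℚ) / (orderOf g : ℚ)).sum

/-- The system of sets of lengths `L(G)`. -/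
def LSystem (G : Type*) [Group G] : Set (Set ℕ) :=
  {L | ∃ A : Multiset G, IsProductOne A ∧ L = lengths A}

/-- The set of products `π(S)` of all orderings of the terms of `S`. -/
def piSet (S : Multiset G) : Set G :=
  {g | ∃ l : List G, (l : Multiset G) = S ∧ l.prod = g}

/-- The sumset `{x₁, -x₁} + ⋯ + {x_s, -x_s}` for a sequence `a = x₁ ⋯ x_s`. -/
def signedSums {α : Type*} [AddCommGroup α] (a : Multiset α) : Set α :=
  {z | ∃ t ≤ a, z = t.sum + t.sum - a.sum}

/-- `Σ_k(T)`: the set of sums of `k`-term subsequences of `T`. -/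
def subseqSums {α : Type*} [AddCommMonoid α] (k : ℕ) (T : Multiset α) : Set α :=
  {z | ∃ t ≤ T, Multiset.card t = k ∧ t.sum = z}

/-- The subsequence `S_X` of all terms of `S` lying in `X`. -/
noncomputable def restrictTo (X : Set G) (S : Multiset G) : Multiset G :=
  letI := Classical.decPred fun g => g ∈ X
  S.filter fun g => g ∈ X

/-- The maximum multiplicity `h(S)` of a term of `S`. -/
noncomputable def maxMultiplicity {α : Type*} (S : Multiset α) : ℕ :=
  letI := Classical.decEq α
  S.toFinset.sup S.count

end ProductOne

namespace ProductOne

open scoped Classical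
open DihedralGroup

section ZeroSumFree

variable {A : Type*} [AddCommGroup A]

/-- A sequence over an abelian group is zero-sum free if the empty sequence is its only
subsequence with sum zero. -/
def ZeroSumFree (S : Multiset A) : Prop := ∀ T ≤ S, T.sum = 0 → T = 0

/-- The finite set of sums of all (possibly empty) subsequences of `S`. -/
noncomputable def subsums (S : Multiset A) : Finset A :=
  (S.powerset.map Multiset.sum).toFinset

lemma mem_subsums {S : Multiset A} {x : A} : x ∈ subsums S ↔ ∃ T ≤ S, T.sum = x := by
  simp [subsums]

lemma ZeroSumFree.mono {S T : Multiset A} (hS : ZeroSumFree S) (h : T ≤ S) :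
    ZeroSumFree T := fun R hR => hS R (hR.trans h)

lemma ZeroSumFree.card_subsums_lt {S : Multiset A} {a : A} (h : ZeroSumFree (a ::ₘ S)) :
    (subsums S).card < (subsums (a ::ₘ S)).card := by
  refine Finset.card_lt_card ((Finset.ssubset_iff_subset_ne).2 ⟨?_, ?_⟩)
  · intro x hx
    obtain ⟨T, hT, rfl⟩ := mem_subsums.1 hx
    exact mem_subsums.2 ⟨T, hT.trans (Multiset.le_cons_self S a), rfl⟩
  · intro heq
    have hsub : (subsums S).image (a + ·) ⊆ subsums S := by
      intro x hx
      obtain ⟨y, hy, rfl⟩ := Finset.mem_image.1 hx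
      obtain ⟨T, hT, rfl⟩ := mem_subsums.1 hy
      rw [heq]
      exact mem_subsums.2 ⟨a ::ₘ T, Multiset.cons_le_cons a hT, by simp⟩
    have himage : (subsums S).image (a + ·) = subsums S :=
      Finset.eq_of_subset_of_card_le hsub
        (Finset.card_image_of_injective _ (add_right_injective a)).ge
    have h0 : (0 : A) ∈ (subsums S).image (a + ·) := by
      rw [himage]
      exact mem_subsums.2 ⟨0, Multiset.zero_le S, rfl⟩
    obtain ⟨y, hy, hay⟩ := Finset.mem_image.1 h0
    obtain ⟨T, hT, rfl⟩ := mem_subsums.1 hy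
    exact Multiset.cons_ne_zero (h (a ::ₘ T) (Multiset.cons_le_cons a hT) (by simpa using hay))

lemma ZeroSumFree.card_subsums_add_le {S : Multiset A} (T : Multiset A)
    (h : ZeroSumFree (T + S)) :
    (subsums S).card + Multiset.card T ≤ (subsums (T + S)).card := by
  induction T using Multiset.induction with
  | empty => simp
  | cons a T ih =>
    rw [Multiset.cons_add] at h ⊢
    have := h.card_subsums_lt
    have := ih (h.mono (Multiset.le_cons_self _ _))
    rw [Multiset.card_cons]
    omega

lemma ZeroSumFree.card_lt_of_forall_mem [Finite A] {S : Multiset A} (h : ZeroSumFree S)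
    (K : AddSubgroup A) (hK : ∀ a ∈ S, a ∈ K) : Multiset.card S < Nat.card K := by
  have h1 := ZeroSumFree.card_subsums_add_le (S := 0) S (by simpa using h)
  have h2 : 0 < (subsums (0 : Multiset A)).card :=
    Finset.card_pos.2 ⟨0, mem_subsums.2 ⟨0, le_rfl, rfl⟩⟩
  have h3 : (subsums S).card ≤ Nat.card K := by
    rw [← Set.ncard_coe_finset]
    change _ ≤ (K : Set A).ncard
    refine Set.ncard_le_ncard fun x hx => ?_
    obtain ⟨T, hT, rfl⟩ := mem_subsums.1 hx
    exact K.multiset_sum_mem T fun a ha => hK a (Multiset.mem_of_le hT ha)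
  rw [add_zero] at h1
  omega

lemma ZeroSumFree.countP_mem_lt [Finite A] {S : Multiset A} (h : ZeroSumFree S)
    (K : AddSubgroup A) : S.countP (· ∈ K) < Nat.card K := by
  rw [Multiset.countP_eq_card_filter]
  exact (h.mono (Multiset.filter_le _ S)).card_lt_of_forall_mem K
    fun a ha => (Multiset.mem_filter.1 ha).2

lemma ZeroSumFree.card_lt_natCard [Finite A] {S : Multiset A} (h : ZeroSumFree S) :
    Multiset.card S < Nat.card A := by
  simpa using h.card_lt_of_forall_mem ⊤ (by simp)

/-- A zero-sum free sequence of length `|A| - 1` contains no element of a proper subgroup. -/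
lemma ZeroSumFree.notMem_of_card [Finite A] {S : Multiset A} (h : ZeroSumFree S)
    (hS : Multiset.card S + 1 = Nat.card A) {K : AddSubgroup A} (hK : Nat.card K < Nat.card A)
    {g : A} (hg : g ∈ K) : g ∉ S := by
  intro hgS
  by_cases hall : ∀ x ∈ S, x = g
  · have := h.card_lt_of_forall_mem K (fun x hx => hall x hx ▸ hg)
    omega
  · push Not at hall
    obtain ⟨x, hxS, hxg⟩ := hall
    obtain ⟨R, rfl⟩ := Multiset.exists_cons_of_mem hgS
    have hxR : x ∈ R := (Multiset.mem_cons.1 hxS).resolve_left hxg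
    obtain ⟨Q, rfl⟩ := Multiset.exists_cons_of_mem hxR
    have hperm : g ::ₘ x ::ₘ Q = Q + {g, x} := by
      rw [add_comm, Multiset.insert_eq_cons, Multiset.cons_add, Multiset.singleton_add]
    rw [hperm] at h hS
    have hgx : ZeroSumFree ({g, x} : Multiset A) := h.mono (Multiset.le_add_left _ _)
    have hne : ∀ T ≤ ({g, x} : Multiset A), T ≠ 0 → T.sum ≠ 0 := fun T hT h0 h1 => h0 (hgx T hT h1)
    have hg0 : g ≠ 0 := by simpa using hne {g} (by simp) (by simp)
    have hx0 : x ≠ 0 := by simpa using hne {x} (by simp) (by simp)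
    have hgx0 : g + x ≠ 0 := by simpa using hne {g, x} le_rfl (by simp)
    have hfour : 4 ≤ (subsums ({g, x} : Multiset A)).card := by
      have hcard : ({0, g, x, g + x} : Finset A).card = 4 := by
        rw [Finset.card_insert_of_notMem, Finset.card_insert_of_notMem,
          Finset.card_pair] <;> simp [*, Ne.symm hg0, Ne.symm hx0, Ne.symm hgx0, Ne.symm hxg]
      rw [← hcard]
      refine Finset.card_le_card fun y hy => ?_
      simp only [Finset.mem_insert, Finset.mem_singleton] at hy
      rcases hy with rfl | rfl | rfl | rfl
      · exact mem_subsums.2 ⟨0, Multiset.zero_le _, rfl⟩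
      · exact mem_subsums.2 ⟨{y}, by simp, by simp⟩
      · exact mem_subsums.2 ⟨{y}, by simp, by simp⟩
      · exact mem_subsums.2 ⟨{g, x}, le_rfl, by simp⟩
    have h1 := h.card_subsums_add_le Q
    have h2 : (subsums (Q + {g, x})).card ≤ Nat.card A := by
      rw [← Set.ncard_coe_finset]
      exact Set.ncard_le_card _
    have h3 : Multiset.card (Q + {g, x}) = Multiset.card Q + 2 := by simp
    omega

end ZeroSumFree

section Pairing

variable {α β : Type*}

lemma _root_.Multiset.exists_le_map_eq {f : α → β} {S : Multiset α} {T : Multiset β}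
    (h : T ≤ S.map f) : ∃ D ≤ S, D.map f = T := by
  induction S using Quotient.inductionOn with | _ s
  induction T using Quotient.inductionOn with | _ t
  obtain ⟨l, hperm, hsub⟩ : List.Subperm t (s.map f) := h
  obtain ⟨d, hd, rfl⟩ := List.sublist_map_iff.1 hsub
  exact ⟨d, hd.subperm, Quotient.sound hperm⟩

lemma exists_pairing {P M : Multiset α} (h : Multiset.card P = Multiset.card M) :
    ∃ C : Multiset (α × α), C.map Prod.fst = P ∧ C.map Prod.snd = M := by
  induction P using Quotient.inductionOn with | _ p
  induction M using Quotient.inductionOn with | _ m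
  have h' : p.length = m.length := by simpa using h
  refine ⟨(p.zip m : List (α × α)), ?_, ?_⟩
  · simp [List.map_fst_zip, h'.le]
  · simp [List.map_snd_zip, h'.ge]

/-- Two sequences of equal length can be matched so that as many terms with property `q` as
possible are matched with each other. -/
lemma exists_pairing_compatible (q : α → Prop) {P M : Multiset α}
    (h : Multiset.card P = Multiset.card M) :
    ∃ C : Multiset (α × α), C.map Prod.fst = P ∧ C.map Prod.snd = M ∧
      ((∀ c ∈ C, q c.2 → q c.1) ∨ ∀ c ∈ C, q c.1 → q c.2) := by
  induction hk : Multiset.card P generalizing P M with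
  | zero =>
    obtain ⟨C, rfl, rfl⟩ := exists_pairing h
    exact ⟨C, rfl, rfl, by simp_all⟩
  | succ k ih =>
    by_cases hP : ∃ p ∈ P, q p
    · by_cases hM : ∃ m ∈ M, q m
      · obtain ⟨p, hp, hqp⟩ := hP
        obtain ⟨m, hm, hqm⟩ := hM
        obtain ⟨P, rfl⟩ := Multiset.exists_cons_of_mem hp
        obtain ⟨M, rfl⟩ := Multiset.exists_cons_of_mem hm
        simp only [Multiset.card_cons, add_left_inj] at h hk
        obtain ⟨C, rfl, rfl, hC⟩ := ih h hk
        refine ⟨(p, m) ::ₘ C, by simp, by simp, hC.imp ?_ ?_⟩ <;>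
        · intro hC c hc
          rcases Multiset.mem_cons.1 hc with rfl | hc
          · simp [hqp, hqm]
          · exact hC c hc
      · obtain ⟨C, rfl, rfl⟩ := exists_pairing h
        exact ⟨C, rfl, rfl, .inl fun c hc hq => (hM ⟨c.2, Multiset.mem_map_of_mem _ hc, hq⟩).elim⟩
    · obtain ⟨C, rfl, rfl⟩ := exists_pairing h
      exact ⟨C, rfl, rfl, .inr fun c hc hq => (hP ⟨c.1, Multiset.mem_map_of_mem _ hc, hq⟩).elim⟩

end Pairing

section Dihedral

variable {n : ℕ}

/-- The sequence over the dihedral group whose rotations are the terms of `X` and `Y` and whose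
reflections are the components of the pairs in `C`. -/
def dihedralSeq (X Y : Multiset (ZMod n)) (C : Multiset (ZMod n × ZMod n)) :
    Multiset (DihedralGroup n) :=
  X.map r + Y.map r + C.map (fun c => sr c.1) + C.map (fun c => sr c.2)

/-- The difference of the two components of a pair. -/
def pairDiff (c : ZMod n × ZMod n) : ZMod n := c.1 - c.2

lemma dihedralSeq_swap (X Y : Multiset (ZMod n)) (C : Multiset (ZMod n × ZMod n)) :
    dihedralSeq Y X (C.map Prod.swap) = dihedralSeq X Y C := by
  simp only [dihedralSeq, Multiset.map_map, Function.comp_def, Prod.fst_swap, Prod.snd_swap]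
  abel

lemma dihedralSeq_add (X X' Y Y' : Multiset (ZMod n)) (C C' : Multiset (ZMod n × ZMod n)) :
    dihedralSeq (X + X') (Y + Y') (C + C') = dihedralSeq X Y C + dihedralSeq X' Y' C' := by
  simp only [dihedralSeq, Multiset.map_add]
  abel

lemma prod_map_r (l : List (ZMod n)) : (l.map r).prod = r l.sum := by
  induction l with
  | nil => rfl
  | cons a l ih => simp [ih]

lemma isProductOne_map_r {X : Multiset (ZMod n)} (h : X.sum = 0) : IsProductOne (X.map r) := by
  induction X using Quotient.inductionOn with | _ l
  refine ⟨l.map r, rfl, ?_⟩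
  rw [prod_map_r, show l.sum = 0 by simpa using h]
  rfl

lemma exists_prod_pairs (C : Multiset (ZMod n × ZMod n)) :
    ∃ l : List (DihedralGroup n), (l : Multiset (DihedralGroup n)) = dihedralSeq 0 0 C ∧
      l.prod = r (C.map pairDiff).sum := by
  induction C using Multiset.induction with
  | empty => exact ⟨[], rfl, rfl⟩
  | cons c C ih =>
    obtain ⟨l, hl, hprod⟩ := ih
    refine ⟨sr c.2 :: sr c.1 :: l, ?_, ?_⟩
    · rw [← Multiset.cons_coe, ← Multiset.cons_coe, hl]
      simp only [dihedralSeq, Multiset.map_cons, Multiset.map_zero, zero_add]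
      simp only [← Multiset.singleton_add]
      abel
    · simp only [List.prod_cons, hprod, sr_mul_r, sr_mul_sr, Multiset.map_cons,
        Multiset.sum_cons, pairDiff]
      congr 1
      ring

lemma isProductOne_dihedralSeq {X Y : Multiset (ZMod n)} {C : Multiset (ZMod n × ZMod n)}
    (hC : C ≠ 0) (h : X.sum - Y.sum + (C.map pairDiff).sum = 0) :
    IsProductOne (dihedralSeq X Y C) := by
  obtain ⟨c, hc⟩ := Multiset.exists_mem_of_ne_zero hC
  obtain ⟨C, rfl⟩ := Multiset.exists_cons_of_mem hc
  obtain ⟨l, hl, hprod⟩ := exists_prod_pairs C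
  induction X using Quotient.inductionOn with | _ x
  induction Y using Quotient.inductionOn with | _ y
  refine ⟨sr c.2 :: (y.map r ++ sr c.1 :: (x.map r ++ l)), ?_, ?_⟩
  · rw [← Multiset.cons_coe, ← Multiset.coe_add, ← Multiset.cons_coe, ← Multiset.coe_add, hl]
    simp only [dihedralSeq, Multiset.map_cons, Multiset.map_zero, zero_add,
      Multiset.quot_mk_to_coe, Multiset.map_coe]
    simp only [← Multiset.singleton_add]
    abel
  · simp only [List.prod_cons, List.prod_append, prod_map_r, hprod, sr_mul_r, r_mul_sr,
      sr_mul_sr, r_mul_r]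
    rw [DihedralGroup.one_def]
    congr 1
    simp only [Multiset.quot_mk_to_coe, Multiset.sum_coe, Multiset.map_cons, Multiset.sum_cons,
      pairDiff] at h
    linear_combination h

/-- Every product in the dihedral group is an alternating sum of its exponents. -/
lemma exists_signs (l : List (DihedralGroup n)) :
    ∃ X Y P M : Multiset (ZMod n),
      (l : Multiset (DihedralGroup n)) = X.map r + Y.map r + P.map sr + M.map sr ∧
      ((l.prod = r (X.sum - Y.sum + (P.sum - M.sum)) ∧ Multiset.card P = Multiset.card M ∧
          (M = 0 → Y = 0)) ∨
        (l.prod = sr (X.sum - Y.sum + (P.sum - M.sum)) ∧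
          Multiset.card P = Multiset.card M + 1)) := by
  induction l with
  | nil => exact ⟨0, 0, 0, 0, rfl, .inl ⟨by simp, rfl, fun _ => rfl⟩⟩
  | cons g l ih =>
    obtain ⟨X, Y, P, M, hl, ⟨hprod, hcard, hY⟩ | ⟨hprod, hcard⟩⟩ := ih
    · rcases g with a | b
      · refine ⟨a ::ₘ X, Y, P, M, ?_, .inl ⟨?_, hcard, hY⟩⟩
        · simp [← Multiset.cons_coe, hl]
        · simp only [List.prod_cons, hprod, r_mul_r, Multiset.sum_cons]
          congr 1
          ring
      · refine ⟨X, Y, b ::ₘ P, M, ?_, .inr ⟨?_, by simp [hcard]⟩⟩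
        · simp [← Multiset.cons_coe, hl]
        · simp only [List.prod_cons, hprod, sr_mul_r, Multiset.sum_cons]
          congr 1
          ring
    · rcases g with a | b
      · refine ⟨X, a ::ₘ Y, P, M, ?_, .inr ⟨?_, hcard⟩⟩
        · simp [← Multiset.cons_coe, hl]
        · simp only [List.prod_cons, hprod, r_mul_sr, Multiset.sum_cons]
          congr 1
          ring
      · refine ⟨X, Y, P, b ::ₘ M, ?_, .inl ⟨?_, by simp [hcard], by simp⟩⟩
        · simp [← Multiset.cons_coe, hl]
        · simp only [List.prod_cons, hprod, sr_mul_sr, Multiset.sum_cons]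
          congr 1
          ring

lemma zeroSumFree_of_isAtomSeq {X Y : Multiset (ZMod n)} {c : ZMod n × ZMod n}
    {C : Multiset (ZMod n × ZMod n)} (hU : IsAtomSeq (dihedralSeq X Y (c ::ₘ C)))
    (h : X.sum - Y.sum + ((c ::ₘ C).map pairDiff).sum = 0) :
    ZeroSumFree (X + C.map pairDiff) := by
  intro T hT hT0
  obtain ⟨T₁, hT₁, T₂, hT₂, rfl⟩ : ∃ T₁ ≤ X, ∃ T₂ ≤ C.map pairDiff, T = T₁ + T₂ :=
    ⟨T ∩ X, Multiset.inter_le_right, T - X, by rwa [tsub_le_iff_left], by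
      rw [add_comm, Multiset.sub_add_inter]⟩
  obtain ⟨D, hD, rfl⟩ := Multiset.exists_le_map_eq hT₂
  obtain ⟨X, rfl⟩ := Multiset.le_iff_exists_add.1 hT₁
  obtain ⟨C, rfl⟩ := Multiset.le_iff_exists_add.1 hD
  have hsplit : dihedralSeq (T₁ + X) Y (c ::ₘ (D + C)) =
      dihedralSeq T₁ 0 D + dihedralSeq X Y (c ::ₘ C) := by
    rw [← dihedralSeq_add, zero_add, Multiset.add_cons]
  rw [Multiset.sum_add] at hT0
  have hfirst : IsProductOne (dihedralSeq T₁ 0 D) := by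
    by_cases hD0 : D = 0
    · subst hD0
      simpa [dihedralSeq] using isProductOne_map_r (X := T₁) (by simpa using hT0)
    · exact isProductOne_dihedralSeq hD0 (by simpa using hT0)
  have hsecond : IsProductOne (dihedralSeq X Y (c ::ₘ C)) := by
    refine isProductOne_dihedralSeq (Multiset.cons_ne_zero) ?_
    simp only [Multiset.map_cons, Multiset.map_add, Multiset.sum_cons, Multiset.sum_add] at h ⊢
    linear_combination h - hT0
  rcases hU.2.2 _ _ hsplit hfirst hsecond with h0 | h0
  · have := congrArg Multiset.card h0
    simp [dihedralSeq] at this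
    simp [this]
  · have := congrArg Multiset.card h0
    simp [dihedralSeq] at this

lemma countP_le_countP_pairDiff (K : AddSubgroup (ZMod n)) (z : ZMod n)
    {C : Multiset (ZMod n × ZMod n)} (hpair : ∀ c ∈ C, c.2 - z ∈ K → c.1 - z ∈ K) :
    C.countP (fun c => c.2 - z ∈ K) ≤ (C.map pairDiff).countP (· ∈ K) := by
  rw [Multiset.countP_map, ← Multiset.countP_eq_card_filter,
    Multiset.countP_congr rfl (p' := fun c => c.2 - z ∈ K ∧ c.1 - z ∈ K)]
  · rw [Multiset.countP_eq_card_filter, Multiset.countP_eq_card_filter]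
    refine Multiset.card_le_card (Multiset.monotone_filter_right C fun c hc => ?_)
    have := K.sub_mem hc.2 hc.1
    rwa [sub_sub_sub_cancel_right] at this
  · intro c hc
    simpa using hpair c hc

lemma countP_pairDiff_swap (K : AddSubgroup (ZMod n)) (C : Multiset (ZMod n × ZMod n)) :
    ((C.map Prod.swap).map pairDiff).countP (· ∈ K) = (C.map pairDiff).countP (· ∈ K) := by
  have hswap : ∀ c : ZMod n × ZMod n, pairDiff c.swap ∈ K ↔ pairDiff c ∈ K := by
    intro c
    rw [← neg_mem_iff]
    simp [pairDiff]
  simp only [Multiset.countP_map, Multiset.filter_map, Multiset.card_map, Function.comp_def,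
    hswap]

lemma sum_pairDiff_swap (C : Multiset (ZMod n × ZMod n)) :
    ((C.map Prod.swap).map pairDiff).sum = -(C.map pairDiff).sum := by
  rw [← Multiset.sum_map_neg, Multiset.map_map]
  congr 1
  exact Multiset.map_congr rfl fun c _ => by simp [pairDiff]

lemma two_mul_natCard_le [NeZero n] {K : AddSubgroup (ZMod n)} (hK : K ≠ ⊤) :
    2 * Nat.card K ≤ n := by
  obtain ⟨k, hk⟩ := K.card_addSubgroup_dvd_card
  rw [Nat.card_zmod] at hk
  have hlt : Nat.card K ≠ n := fun h => hK (K.eq_top_of_card_eq (by rw [h, Nat.card_zmod]))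
  have hn : n ≠ 0 := NeZero.ne n
  rcases k with _ | _ | k
  · omega
  · omega
  · nlinarith

/-- Counting form of the bound, for a signed representation of the atom in which every pair
whose second component lies in the coset `z + K` also has its first component there. -/
lemma card_bound_of_pairing [NeZero n] (hn : 3 ≤ n) {K : AddSubgroup (ZMod n)}
    (hK : K ≠ ⊤) (z : ZMod n) {X Y : Multiset (ZMod n)} {C : Multiset (ZMod n × ZMod n)}
    (hC : C ≠ 0) (hU : IsAtomSeq (dihedralSeq X Y C))
    (h : X.sum - Y.sum + (C.map pairDiff).sum = 0)
    (hpair : ∀ c ∈ C, c.2 - z ∈ K → c.1 - z ∈ K) :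
    X.countP (· ∈ K) + Y.countP (· ∈ K) + C.countP (fun c => c.1 - z ∈ K) +
        C.countP (fun c => c.2 - z ∈ K) ≤ n + Nat.card K - 1 ∧
      (X.countP (· ∈ K) + Y.countP (· ∈ K) + C.countP (fun c => c.1 - z ∈ K) +
        C.countP (fun c => c.2 - z ∈ K) = n + Nat.card K - 1 → Nat.card K = 1) := by
  have hKcard := two_mul_natCard_le hK
  obtain ⟨c, D, rfl, hc⟩ : ∃ c D, C = c ::ₘ D ∧
      (c.2 - z ∈ K → ∀ d ∈ D, d.2 - z ∈ K) := by
    by_cases hall : ∀ c ∈ C, c.2 - z ∈ K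
    · obtain ⟨c, hc⟩ := Multiset.exists_mem_of_ne_zero hC
      obtain ⟨D, rfl⟩ := Multiset.exists_cons_of_mem hc
      exact ⟨c, D, rfl, fun _ d hd => hall d (Multiset.mem_cons_of_mem hd)⟩
    · push Not at hall
      obtain ⟨c, hc, hcK⟩ := hall
      obtain ⟨D, rfl⟩ := Multiset.exists_cons_of_mem hc
      exact ⟨c, D, rfl, fun h => (hcK h).elim⟩
  have hX := zeroSumFree_of_isAtomSeq hU h
  have hY : ZeroSumFree (Y + (D.map Prod.swap).map pairDiff) := by
    refine zeroSumFree_of_isAtomSeq (c := c.swap) (Y := X) ?_ ?_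
    · rwa [← Multiset.map_cons, dihedralSeq_swap]
    · rw [← Multiset.map_cons, sum_pairDiff_swap]
      linear_combination -h
  have hXK := hX.countP_mem_lt K
  have hYK := hY.countP_mem_lt K
  have hXn := hX.card_lt_natCard
  have hYn := hY.card_lt_natCard
  rw [Multiset.countP_add] at hXK
  rw [Multiset.countP_add, countP_pairDiff_swap] at hYK
  rw [Nat.card_zmod] at hXn hYn
  simp only [Multiset.card_add, Multiset.card_map] at hXn hYn
  have hD := countP_le_countP_pairDiff K z fun d hd => hpair d (Multiset.mem_cons_of_mem hd)
  have hXle := X.countP_le_card (· ∈ K)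
  have hYle := Y.countP_le_card (· ∈ K)
  have hDle := D.countP_le_card (fun c => c.1 - z ∈ K)
  rw [Multiset.countP_cons, Multiset.countP_cons]
  by_cases hcK : c.2 - z ∈ K
  · have hall := Multiset.countP_eq_card.2 (hc hcK)
    rw [if_pos hcK, if_pos (hpair c (Multiset.mem_cons_self c D) hcK)]
    omega
  · rw [if_neg hcK]
    have hite : (if c.1 - z ∈ K then 1 else 0) ≤ 1 := by split_ifs <;> omega
    refine ⟨by omega, fun heq => ?_⟩
    by_contra hone
    have hpos : 0 < (X + D.map pairDiff).countP (· ∈ K) := by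
      rw [Multiset.countP_add]
      omega
    obtain ⟨g, hg, hgK⟩ := Multiset.countP_pos.1 hpos
    refine hX.notMem_of_card ?_ ?_ hgK hg
    · rw [Nat.card_zmod, Multiset.card_add, Multiset.card_map]
      omega
    · rw [Nat.card_zmod]
      omega

/-- The bound for atoms consisting of rotations only. -/
lemma countP_le_natCard_of_isAtomSeq_map_r [NeZero n] (K : AddSubgroup (ZMod n))
    {X : Multiset (ZMod n)} (hU : IsAtomSeq (X.map r)) (h : X.sum = 0) :
    X.countP (· ∈ K) ≤ Nat.card K := by
  obtain rfl | ⟨a, ha⟩ := X.empty_or_exists_mem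
  · simp
  obtain ⟨S, rfl⟩ := Multiset.exists_cons_of_mem ha
  have hS : ZeroSumFree S := by
    intro T hT hT0
    obtain ⟨R, rfl⟩ := Multiset.le_iff_exists_add.1 hT
    have hR : (a ::ₘ R).sum = 0 := by
      simp only [Multiset.sum_cons, Multiset.sum_add] at h ⊢
      linear_combination h - hT0
    have hsplit : (a ::ₘ (T + R)).map r = T.map r + (a ::ₘ R).map r := by
      rw [← Multiset.map_add, Multiset.add_cons]
    simpa using hU.2.2 _ _ hsplit (isProductOne_map_r hT0) (isProductOne_map_r hR)
  have := hS.countP_mem_lt K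
  rw [Multiset.countP_cons]
  split_ifs <;> omega

/-- The exponents of the rotations lying in a subgroup of the dihedral group. -/
def rotationExponents (H : Subgroup (DihedralGroup n)) : AddSubgroup (ZMod n) where
  carrier := {i | r i ∈ H}
  zero_mem' := H.one_mem
  add_mem' := fun ha hb => by simpa using H.mul_mem ha hb
  neg_mem' := fun ha => by simpa using H.inv_mem ha

lemma mem_rotationExponents {H : Subgroup (DihedralGroup n)} {i : ZMod n} :
    i ∈ rotationExponents H ↔ r i ∈ H := Iff.rfl

lemma exists_eq_r_of_mem {H : Subgroup (DihedralGroup n)} (hH : H ≤ Subgroup.zpowers (r 1))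
    {g : DihedralGroup n} (hg : g ∈ H) : ∃ i, g = r i := by
  obtain ⟨k, rfl⟩ := Subgroup.mem_zpowers_iff.1 (hH hg)
  exact ⟨k, by simp⟩

lemma natCard_rotationExponents {H : Subgroup (DihedralGroup n)}
    (hH : H ≤ Subgroup.zpowers (r 1)) : Nat.card (rotationExponents H) = Nat.card H := by
  refine Nat.card_congr (Equiv.ofBijective (fun i => ⟨r i.1, i.2⟩) ⟨?_, ?_⟩)
  · intro i j hij
    exact Subtype.ext (r.inj (Subtype.ext_iff.1 hij))
  · rintro ⟨g, hg⟩
    obtain ⟨i, rfl⟩ := exists_eq_r_of_mem hH hg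
    exact ⟨⟨i, hg⟩, rfl⟩

/-- The elements of `⟨H, τα^z⟩` are the rotations in `H` and the reflections in `τα^z H`. -/
lemma mem_sup_zpowers_sr {H : Subgroup (DihedralGroup n)} (hH : H ≤ Subgroup.zpowers (r 1))
    {z : ZMod n} {g : DihedralGroup n} (hg : g ∈ H ⊔ Subgroup.zpowers (sr z)) :
    (∀ i, g = r i → i ∈ rotationExponents H) ∧
      ∀ i, g = sr i → i - z ∈ rotationExponents H := by
  let L : Subgroup (DihedralGroup n) :=
    { carrier := {g | (∀ i, g = r i → i ∈ rotationExponents H) ∧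
        ∀ i, g = sr i → i - z ∈ rotationExponents H}
      one_mem' := by
        refine ⟨fun i hi => ?_, fun i hi => by cases hi⟩
        rw [mem_rotationExponents, ← hi]
        exact H.one_mem
      mul_mem' := by
        rintro (a | a) (b | b) ha hb <;>
          simp only [Set.mem_ofPred_eq, r.injEq, sr.injEq, reduceCtorEq, false_imp_iff,
            imp_true_iff, and_true, true_and, forall_eq', r_mul_r, r_mul_sr, sr_mul_r,
            sr_mul_sr] at ha hb ⊢
        · exact add_mem ha hb
        · convert sub_mem hb ha using 1; ring
        · convert add_mem ha hb using 1; ring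
        · convert sub_mem hb ha using 1; ring
      inv_mem' := by
        rintro (a | a) ha <;>
          simp only [Set.mem_ofPred_eq, r.injEq, sr.injEq, reduceCtorEq, false_imp_iff,
            imp_true_iff, and_true, true_and, forall_eq', inv_r, inv_sr] at ha ⊢
        · exact neg_mem ha
        · exact ha }
  have hle : H ⊔ Subgroup.zpowers (sr z) ≤ L := by
    refine sup_le (fun g hg => ?_) ?_
    · obtain ⟨j, rfl⟩ := exists_eq_r_of_mem hH hg
      exact ⟨fun i hi => mem_rotationExponents.2 (hi ▸ hg), fun i hi => by cases hi⟩
    · refine Subgroup.zpowers_le.2 ⟨fun i hi => (by cases hi), fun i hi => ?_⟩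
      rw [← sr.inj hi, sub_self]
      exact zero_mem _
  exact hle hg

lemma rotationExponents_ne_top {H : Subgroup (DihedralGroup n)} {z : ZMod n}
    (hproper : H ⊔ Subgroup.zpowers (sr z) ≠ ⊤) : rotationExponents H ≠ ⊤ := by
  intro htop
  have hr : ∀ i, r i ∈ H := fun i => mem_rotationExponents.1 (htop ▸ AddSubgroup.mem_top i)
  refine hproper (eq_top_iff.2 fun g _ => ?_)
  rcases g with i | i
  · exact Subgroup.mem_sup_left (hr i)
  · have := mul_mem (Subgroup.mem_sup_right (S := H) (Subgroup.mem_zpowers (sr z)))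
      (Subgroup.mem_sup_left (T := Subgroup.zpowers (sr z)) (hr (i - z)))
    simpa using this

lemma card_restrictTo_le {H : Subgroup (DihedralGroup n)} (hH : H ≤ Subgroup.zpowers (r 1))
    (z : ZMod n) (X Y : Multiset (ZMod n)) (C : Multiset (ZMod n × ZMod n)) :
    Multiset.card (restrictTo (H ⊔ Subgroup.zpowers (sr z) : Subgroup (DihedralGroup n))
      (dihedralSeq X Y C)) ≤
      X.countP (· ∈ rotationExponents H) + Y.countP (· ∈ rotationExponents H) +
        C.countP (fun c => c.1 - z ∈ rotationExponents H) +
        C.countP (fun c => c.2 - z ∈ rotationExponents H) := by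
  have hr : ∀ i, r i ∈ H ⊔ Subgroup.zpowers (sr z) → i ∈ rotationExponents H :=
    fun i hi => (mem_sup_zpowers_sr hH hi).1 i rfl
  have hsr : ∀ i, sr i ∈ H ⊔ Subgroup.zpowers (sr z) → i - z ∈ rotationExponents H :=
    fun i hi => (mem_sup_zpowers_sr hH hi).2 i rfl
  simp only [restrictTo, dihedralSeq, Multiset.filter_add, Multiset.card_add,
    Multiset.filter_map, Multiset.card_map, Multiset.countP_eq_card_filter]
  gcongr <;> refine Multiset.monotone_filter_right _ fun a ha => ?_
  exacts [hr a ha, hr a ha, hsr _ ha, hsr _ ha]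

lemma card_restrictTo_bound_of_pairing [NeZero n] (hn : 3 ≤ n) {H : Subgroup (DihedralGroup n)}
    (hH : H ≤ Subgroup.zpowers (r 1)) {z : ZMod n}
    (hproper : H ⊔ Subgroup.zpowers (sr z) ≠ ⊤) {X Y : Multiset (ZMod n)}
    {C : Multiset (ZMod n × ZMod n)} (hC : C ≠ 0) (hU : IsAtomSeq (dihedralSeq X Y C))
    (h : X.sum - Y.sum + (C.map pairDiff).sum = 0)
    (hpair : ∀ c ∈ C, c.2 - z ∈ rotationExponents H → c.1 - z ∈ rotationExponents H) :
    Multiset.card (restrictTo (H ⊔ Subgroup.zpowers (sr z) : Subgroup (DihedralGroup n))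
        (dihedralSeq X Y C)) ≤ n + Nat.card H - 1 ∧
      (Multiset.card (restrictTo (H ⊔ Subgroup.zpowers (sr z) : Subgroup (DihedralGroup n))
        (dihedralSeq X Y C)) = n + Nat.card H - 1 → H = ⊥) := by
  rw [← Subgroup.card_eq_one, ← natCard_rotationExponents hH]
  have hle := card_restrictTo_le hH z X Y C
  have hbound :=
    card_bound_of_pairing hn (rotationExponents_ne_top hproper) z hC hU h hpair
  exact ⟨hle.trans hbound.1, fun heq => hbound.2 (le_antisymm hbound.1 (heq ▸ hle))⟩

end Dihedral

end ProductOne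

open ProductOne DihedralGroup in
/-- Let `n ≥ 3` be odd, `H ≤ ⟨α⟩` a subgroup of `D_{2n}` and
`z ∈ ℤ/nℤ` with `H_z = ⟨H, τα^z⟩` a proper subgroup of `D_{2n}`, and let `U` be an atom
of `B(D_{2n})`. Then `|U_{H_z}| ≤ n + |H| - 1`, with equality only possible if `H` is
trivial. -/
theorem card_restrict_to_proper_subgroup (n : ℕ) (hn : 3 ≤ n) (hodd : Odd n)
    (H : Subgroup (DihedralGroup n)) (hH : H ≤ Subgroup.zpowers (DihedralGroup.r 1))
    (z : ZMod n)
    (hproper : H ⊔ Subgroup.zpowers (DihedralGroup.sr z) ≠ ⊤)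
    (U : Multiset (DihedralGroup n)) (hU : IsAtomSeq U) :
    Multiset.card (restrictTo
        ((H ⊔ Subgroup.zpowers (DihedralGroup.sr z) : Subgroup (DihedralGroup n)) :
          Set (DihedralGroup n)) U) ≤ n + Nat.card H - 1 ∧
    (Multiset.card (restrictTo
        ((H ⊔ Subgroup.zpowers (DihedralGroup.sr z) : Subgroup (DihedralGroup n)) :
          Set (DihedralGroup n)) U) = n + Nat.card H - 1 → H = ⊥) := by
  have : NeZero n := ⟨by omega⟩
  obtain ⟨l, hl, hprod⟩ := hU.2.1
  obtain ⟨X, Y, P, M, hU', hsign⟩ := exists_signs l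
  rw [hl] at hU'
  rw [hprod, DihedralGroup.one_def] at hsign
  obtain ⟨hsum, hcard, hM⟩ := hsign.resolve_right (fun h => by cases h.1)
  rw [r.injEq] at hsum
  obtain ⟨C, rfl, rfl, hC⟩ :=
    exists_pairing_compatible (fun i => i - z ∈ rotationExponents H) hcard
  replace hU' : U = dihedralSeq X Y C := by
    rw [hU', dihedralSeq, Multiset.map_map, Multiset.map_map]
    rfl
  subst hU'
  obtain rfl | hC0 := eq_or_ne C 0
  · obtain rfl : Y = 0 := hM rfl
    have hKcard := two_mul_natCard_le (rotationExponents_ne_top hproper)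
    have hle := card_restrictTo_le hH z X 0 0
    have hX := countP_le_natCard_of_isAtomSeq_map_r (rotationExponents H) (X := X)
      (by simpa [dihedralSeq] using hU) (by simpa using hsum.symm)
    rw [natCard_rotationExponents hH] at hKcard hX
    simp only [Multiset.countP_zero, add_zero] at hle
    omega
  have hzero : X.sum - Y.sum + (C.map pairDiff).sum = 0 := by
    rw [hsum, show (C.map pairDiff).sum = (C.map Prod.fst).sum - (C.map Prod.snd).sum from
      Multiset.sum_map_sub]
  rcases hC with hC | hC
  · exact card_restrictTo_bound_of_pairing hn hH hproper hC0 hU hzero hC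
  · rw [← dihedralSeq_swap] at hU ⊢
    refine card_restrictTo_bound_of_pairing hn hH hproper (by simpa using hC0) hU ?_ ?_
    · rw [sum_pairDiff_swap]
      linear_combination -hzero
    · intro c hc
      obtain ⟨d, hd, rfl⟩ := Multiset.mem_map.1 hc
      exact hC d hd
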